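/- arXiv:1211.3313 — 2 statements merged into one kernel-verified Lean document; each statement's English description precedes it below -/
import Mathlib

section
/- FWER control of Hommel and Bernhard's P3 procedure. Let ℋ be finite and suppose raw p-values {p_H}_{H∈ℋ} are given. Define, for ℛ ⊆ ℋ and H ∈ ℋ, α_H(ℛ) = min{α/|𝒯(M)| : M ∈ H, 𝒯(M) ∩ ℛ = ∅}, with the convention α_H(ℛ) = 1 if no M ∈ H has 𝒯(M) ∩ ℛ = ∅ (note that M ∈ H implies H ∈ 𝒯(M), so |𝒯(M)| ≥ 1 in the minimum). Then the sequentially rejective procedure with successor function 𝒩(ℛ) = {H ∈ ℋ \ ℛ : p_H ≤ α_H(ℛ)} satisfies P_M(ℛ_∞ ⊆ ℱ(M)) ≥ 1 − α for every M ∈ 𝕄. -/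
open MeasureTheory Set Classical

/-- The sequentially rejective procedure based on a (possibly random) successor
function `N`: `ℛ₀ = ∅`, `ℛ_{i+1} = ℛ_i ∪ N(ℛ_i)`. -/
def seqRej {ι Ω : Type*} (N : Set ι → Ω → Set ι) (ω : Ω) : ℕ → Set ι
  | 0 => ∅
  | n + 1 => seqRej N ω n ∪ N (seqRej N ω n) ω

/-- A sequentially rejective procedure whose successor function never leaves `F` from inside `F`
stays inside `F`. -/
theorem seqRej_subset {ι Ω : Type*} {N : Set ι → Ω → Set ι} {ω : Ω} {F : Set ι}
    (h : ∀ R ⊆ F, N R ω ⊆ F) (n : ℕ) : seqRej N ω n ⊆ F := by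
  induction n with
  | zero => exact Set.empty_subset F
  | succ n ih => exact Set.union_subset ih (h _ ih)

/-- **FWER control of Hommel and Bernhard's P3 procedure.**  Hypotheses are
indexed by the finite type `ι` (`hyp i ⊆ 𝕄`); `𝒯(M) = {j | M ∈ hyp j}`.  The
critical value for hypothesis `i` is
`a i R = min {α/|𝒯(M)| : M ∈ hyp i, 𝒯(M) ∩ R = ∅}` (and `a i R = 1` if no such `M`
exists; note `M ∈ hyp i` implies `i ∈ 𝒯(M)`, so `|𝒯(M)| ≥ 1` in the minimum).
The sequentially rejective procedure with successor `N(R) = {i ∉ R : p i ≤ a i R}`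
controls the FWER at level `α`. -/
theorem hommel_bernhard_P3_fwer_control
    {Ω : Type*} [MeasurableSpace Ω] {𝕄 : Type*} {ι : Type*} [Fintype ι]
    (P : 𝕄 → Measure Ω) (hP : ∀ M, IsProbabilityMeasure (P M))
    (hyp : ι → Set 𝕄) (hproper : ∀ i, hyp i ≠ Set.univ)
    (α : ℝ) (hα0 : 0 ≤ α) (hα1 : α ≤ 1)
    (p : ι → Ω → ℝ) (hpmeas : ∀ i, Measurable (p i))
    (hprange : ∀ i ω, p i ω ∈ Set.Icc (0 : ℝ) 1)
    (hpval : ∀ (M : 𝕄) (i : ι), M ∈ hyp i → ∀ u ∈ Set.Icc (0 : ℝ) 1,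
      P M {ω | p i ω ≤ u} ≤ ENNReal.ofReal u)
    (a : ι → Set ι → ℝ)
    (ha1 : ∀ (i : ι) (R : Set ι),
      (∃ M : 𝕄, M ∈ hyp i ∧ (∀ j, M ∈ hyp j → j ∉ R)) →
      a i R = sInf {x : ℝ | ∃ M : 𝕄, M ∈ hyp i ∧ (∀ j, M ∈ hyp j → j ∉ R) ∧
        x = α / ((Finset.univ.filter (fun j => M ∈ hyp j)).card : ℝ)})
    (ha2 : ∀ (i : ι) (R : Set ι),
      (¬ ∃ M : 𝕄, M ∈ hyp i ∧ (∀ j, M ∈ hyp j → j ∉ R)) → a i R = 1)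
    (N : Set ι → Ω → Set ι)
    (hN : ∀ R ω, N R ω = {i | i ∉ R ∧ p i ω ≤ a i R}) :
    ∀ M : 𝕄,
      1 - ENNReal.ofReal α ≤ P M {ω | (⋃ n, seqRej N ω n) ⊆ {i | M ∉ hyp i}} := by
  intro M
  have := hP M
  set T : Finset ι := Finset.univ.filter (fun j => M ∈ hyp j) with hT
  have hmem : ∀ i, i ∈ T ↔ M ∈ hyp i := by simp [hT]
  set c : ℝ := α / (T.card : ℝ) with hc
  have hbad : P M (⋃ i ∈ T, {ω | p i ω ≤ c}) ≤ ENNReal.ofReal α := by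
    rcases T.eq_empty_or_nonempty with h0 | hne
    · simp [h0]
    have hcard : (1 : ℝ) ≤ T.card := by exact_mod_cast hne.card_pos
    have hc0 : 0 ≤ c := by positivity
    have hc1 : c ≤ 1 := (div_le_self hα0 hcard).trans hα1
    calc P M (⋃ i ∈ T, {ω | p i ω ≤ c})
        ≤ ∑ i ∈ T, P M {ω | p i ω ≤ c} := measure_biUnion_finset_le _ _
      _ ≤ ∑ i ∈ T, ENNReal.ofReal c :=
          Finset.sum_le_sum fun i hi => hpval M i ((hmem i).1 hi) c ⟨hc0, hc1⟩
      _ = ENNReal.ofReal (∑ i ∈ T, c) := (ENNReal.ofReal_sum_of_nonneg fun _ _ => hc0).symm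
      _ = ENNReal.ofReal α := by
          rw [Finset.sum_const, nsmul_eq_mul, hc, mul_div_cancel₀ α (by positivity)]
  have hcrit : ∀ R ⊆ {i | M ∉ hyp i}, ∀ i, M ∈ hyp i → a i R ≤ c := by
    intro R hR i hi
    have hMR : ∀ j, M ∈ hyp j → j ∉ R := fun j hj hjR => hR hjR hj
    rw [ha1 i R ⟨M, hi, hMR⟩]
    refine csInf_le ⟨0, ?_⟩ ⟨M, hi, hMR, rfl⟩
    rintro x ⟨M', -, -, rfl⟩
    positivity
  rw [tsub_le_iff_right, ← measure_univ (μ := P M)]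
  refine ((measure_mono fun ω _ => ?_).trans (measure_union_le _ _)).trans
    (add_le_add_right hbad _)
  by_cases hω : ω ∈ ⋃ i ∈ T, {ω | p i ω ≤ c}
  · exact Or.inr hω
  refine Or.inl (Set.iUnion_subset (seqRej_subset fun R hR i hiN hi => hω ?_))
  rw [hN] at hiN
  exact Set.mem_biUnion ((hmem i).2 hi) (hiN.2.trans (hcrit R hR i hi))
end

section
/- FWER control of the partitioning procedure as a sequentially rejective procedure. Let ℋ be finite and let 𝒫 ⊆ ℋ be such that any two distinct members of 𝒫 are disjoint and every H ∈ ℋ is a union of members of 𝒫. Suppose raw p-values {p_H}_{H∈ℋ} are given, and define α_H(ℛ) = α if H ∈ 𝒫; α_H(ℛ) = 1 if H ∈ ℋ \ 𝒫 and H ⊆ ⋃ℛ; and α_H(ℛ) = 0 otherwise. Then the sequentially rejective procedure with successor function 𝒩(ℛ) = {H ∈ ℋ \ ℛ : p_H ≤ α_H(ℛ)} satisfies P_M(ℛ_∞ ⊆ ℱ(M)) ≥ 1 − α for every M ∈ 𝕄. -/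
open MeasureTheory Set Classical

/-- An invariant of every successor step holds throughout the sequentially rejective procedure. -/
lemma iUnion_seqRej_subset {ι Ω : Type*} {N : Set ι → Ω → Set ι} {ω : Ω} {F : Set ι}
    (h : ∀ R ⊆ F, N R ω ⊆ F) : (⋃ n, seqRej N ω n) ⊆ F := by
  refine Set.iUnion_subset fun n => ?_
  induction n with
  | zero => exact Set.empty_subset F
  | succ n ih => exact Set.union_subset ih (h _ ih)

/-- **FWER control of the partitioning procedure as a sequentially rejective
procedure.**  Here `ℋ` is a finite collection of null hypotheses (proper subsets
of the model space `𝕄`), and `Pt ⊆ ℋ` is a partitioning: distinct members of `Pt`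
are disjoint, and every `H ∈ ℋ` is a union of members of `Pt`.  The critical value
is `α` if `H ∈ Pt`, `1` if `H ∈ ℋ \ Pt` and `H ⊆ ⋃ℛ`, and `0` otherwise.  The
sequentially rejective procedure with successor `N(ℛ) = {H ∈ ℋ \ ℛ : p H ≤ α_H(ℛ)}`
controls the FWER at level `α`. -/
theorem partitioning_fwer_control
    {Ω : Type*} [MeasurableSpace Ω] {𝕄 : Type*}
    (P : 𝕄 → Measure Ω) (hP : ∀ M, IsProbabilityMeasure (P M))
    (ℋ : Finset (Set 𝕄)) (hproper : ∀ H ∈ ℋ, H ≠ Set.univ)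
    (Pt : Finset (Set 𝕄)) (hPH : Pt ⊆ ℋ)
    (hdisj : ∀ J ∈ Pt, ∀ K ∈ Pt, J ≠ K → J ∩ K = ∅)
    (hpart : ∀ H ∈ ℋ, ∃ 𝒦 : Finset (Set 𝕄), 𝒦 ⊆ Pt ∧ H = ⋃₀ ↑𝒦)
    (α : ℝ) (hα0 : 0 ≤ α) (hα1 : α ≤ 1)
    (p : Set 𝕄 → Ω → ℝ) (hpmeas : ∀ H, Measurable (p H))
    (hprange : ∀ H ω, p H ω ∈ Set.Icc (0 : ℝ) 1)
    (hpval : ∀ (M : 𝕄), ∀ H ∈ ℋ, M ∈ H → ∀ u ∈ Set.Icc (0 : ℝ) 1,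
      P M {ω | p H ω ≤ u} ≤ ENNReal.ofReal u)
    (N : Set (Set 𝕄) → Ω → Set (Set 𝕄))
    (hN : ∀ R ω, N R ω = {H | H ∈ ℋ ∧ H ∉ R ∧
      p H ω ≤ (if H ∈ Pt then α else if H ⊆ ⋃₀ R then 1 else 0)}) :
    ∀ M : 𝕄,
      1 - ENNReal.ofReal α ≤
        P M {ω | (⋃ n, seqRej N ω n) ⊆ {H | H ∈ ℋ ∧ M ∉ H}} := by
  intro M
  have := hP M
  set S : Set Ω := {ω | (⋃ n, seqRej N ω n) ⊆ {H | H ∈ ℋ ∧ M ∉ H}}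
  set A : Set Ω := {ω | ∃ H ∈ Pt, M ∈ H ∧ p H ω ≤ α}
  set B : Set Ω := ⋃ H ∈ {H | H ∈ ℋ ∧ M ∈ H}, {ω | p H ω ≤ 0}
  have hA : P M A ≤ ENNReal.ofReal α := by
    by_cases hJ : ∃ J ∈ Pt, M ∈ J
    · obtain ⟨J, hJ, hMJ⟩ := hJ
      refine (measure_mono ?_).trans (hpval M J (hPH hJ) hMJ α ⟨hα0, hα1⟩)
      rintro ω ⟨H, hH, hMH, hle⟩
      have hHJ : H = J := by
        by_contra hne
        have hM : M ∈ H ∩ J := ⟨hMH, hMJ⟩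
        rw [hdisj H hH J hJ hne] at hM
        exact hM
      exact hHJ ▸ hle
    · have hempty : A = ∅ :=
        Set.eq_empty_of_forall_notMem fun ω ⟨H, hH, hMH, _⟩ => hJ ⟨H, hH, hMH⟩
      simp [hempty]
  have hB : P M B = 0 := by
    have hfin : {H | H ∈ ℋ ∧ M ∈ H}.Finite := ℋ.finite_toSet.subset fun H hH => hH.1
    refine (measure_biUnion_null_iff hfin.countable).2 fun H hH => ?_
    simpa using hpval M H hH.1 hH.2 0 ⟨le_rfl, zero_le_one⟩
  have hSAB : Sᶜ ⊆ A ∪ B := by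
    intro ω hω
    by_contra hAB
    refine hω (iUnion_seqRej_subset fun R hR H hH => ?_)
    rw [hN] at hH
    obtain ⟨hHℋ, -, hle⟩ := hH
    refine ⟨hHℋ, fun hMH => ?_⟩
    split_ifs at hle with hPt hsub
    · exact hAB (Or.inl ⟨H, hPt, hMH, hle⟩)
    · obtain ⟨K, hK, hMK⟩ := hsub hMH
      exact (hR hK).2 hMK
    · exact hAB (Or.inr (Set.mem_biUnion (show H ∈ {H | H ∈ ℋ ∧ M ∈ H} from ⟨hHℋ, hMH⟩) hle))
  have hcompl : P M Sᶜ ≤ ENNReal.ofReal α :=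
    calc P M Sᶜ ≤ P M A + P M B := (measure_mono hSAB).trans (measure_union_le A B)
      _ ≤ ENNReal.ofReal α := by rw [hB, add_zero]; exact hA
  rw [tsub_le_iff_right]
  calc 1 = P M (S ∪ Sᶜ) := by rw [Set.union_compl_self, measure_univ]
    _ ≤ P M S + P M Sᶜ := measure_union_le S Sᶜ
    _ ≤ P M S + ENNReal.ofReal α := by gcongr
end
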